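/- Let N ≥ 1 and let k be an N×N real symmetric matrix with all entries strictly positive. Define d_i = Σ_j k_{ij}, the row-stochastic matrix T with T_{ij} = k_{ij}/d_i, and the probability vector π with π_i = d_i / Σ_j d_j. Then: (a) π is a stationary distribution of T, i.e. πᵀT = πᵀ; and (b) for every b ∈ ℝ^N with Σ_i π_i b_i = 0, there exists a unique Φ ∈ ℝ^N with Σ_i π_i Φ_i = 0 satisfying the fixed-point equation Φ = T Φ + b. -/

import Mathlib

open Matrix

lemma markov_fixed_unique (N : ℕ) (hN : 1 ≤ N) (T : Matrix (Fin N) (Fin N) ℝ) (p : Fin N → ℝ)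
    (hT : ∀ i j, 0 < T i j) (hrow : ∀ i, ∑ j, T i j = 1) (hp : ∑ i, p i = 1)
    (Φ : Fin N → ℝ) (h0 : ∑ i, p i * Φ i = 0) (hfix : Φ = T.mulVec Φ) : Φ = 0 := by
  haveI : Nonempty (Fin N) := ⟨⟨0, hN⟩⟩
  obtain ⟨i, hi⟩ := Finite.exists_max Φ
  have hs : ∑ j, T i j * (Φ i - Φ j) = 0 := by
    have h1 : Φ i = ∑ j, T i j * Φ j := congrFun hfix i
    simp only [mul_sub, Finset.sum_sub_distrib]
    rw [← Finset.sum_mul, hrow, ← h1]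
    ring
  have hc : ∀ j, Φ j = Φ i := by
    intro j
    have h2 := (Finset.sum_eq_zero_iff_of_nonneg
      (fun j _ => mul_nonneg (hT i j).le (sub_nonneg.2 (hi j)))).1 hs j (Finset.mem_univ j)
    rcases mul_eq_zero.1 h2 with h | h
    · exact absurd h (hT i j).ne'
    · linarith
  have h3 : Φ i = 0 := by
    simp only [hc] at h0
    rw [← Finset.sum_mul, hp] at h0
    linarith
  funext j
  simp [hc j, h3]

lemma markov_sum_mulVec (N : ℕ) (T : Matrix (Fin N) (Fin N) ℝ) (p : Fin N → ℝ)
    (hst : ∀ j, ∑ i, p i * T i j = p j) (Φ : Fin N → ℝ) :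
    ∑ i, p i * (T.mulVec Φ) i = ∑ i, p i * Φ i := by
  have h : p ᵥ* T = p := funext hst
  have h2 := Matrix.dotProduct_mulVec p T Φ
  rw [h] at h2
  exact h2

lemma markov_poisson (N : ℕ) (hN : 1 ≤ N) (T : Matrix (Fin N) (Fin N) ℝ) (p : Fin N → ℝ)
    (hT : ∀ i j, 0 < T i j) (hrow : ∀ i, ∑ j, T i j = 1) (hp : ∑ i, p i = 1)
    (hst : ∀ j, ∑ i, p i * T i j = p j) (b : Fin N → ℝ) (hb : ∑ i, p i * b i = 0) :
    ∃! Φ : Fin N → ℝ, (∑ i, p i * Φ i = 0) ∧ Φ = T.mulVec Φ + b := by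
  let M : Matrix (Fin N) (Fin N) ℝ := 1 - T + Matrix.of fun _ j => p j
  have hM : ∀ Φ i, (M.mulVec Φ) i = Φ i - (T.mulVec Φ) i + ∑ j, p j * Φ j := by
    intro Φ i
    simp only [M, Matrix.add_mulVec, Matrix.sub_mulVec, Matrix.one_mulVec]
    rfl
  have hpM : ∀ Φ, ∑ i, p i * (M.mulVec Φ) i = ∑ j, p j * Φ j := by
    intro Φ
    simp only [hM, mul_add, mul_sub, Finset.sum_add_distrib, Finset.sum_sub_distrib]
    rw [markov_sum_mulVec N T p hst, ← Finset.sum_mul, hp]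
    ring
  have hinj : Function.Injective M.mulVecLin := by
    rw [← LinearMap.ker_eq_bot, LinearMap.ker_eq_bot']
    intro Φ hΦ
    have hΦ' : M.mulVec Φ = 0 := hΦ
    have h0 := hpM Φ
    rw [hΦ'] at h0
    simp only [Pi.zero_apply, mul_zero, Finset.sum_const_zero] at h0
    refine markov_fixed_unique N hN T p hT hrow hp Φ h0.symm (funext fun i => ?_)
    have h1 := hM Φ i
    rw [hΦ', ← h0] at h1
    simp only [Pi.zero_apply] at h1
    linarith
  obtain ⟨Φ, hΦ⟩ := LinearMap.injective_iff_surjective.1 hinj b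
  have hΦ' : M.mulVec Φ = b := hΦ
  have h0 : ∑ i, p i * Φ i = 0 := by rw [← hpM, hΦ', hb]
  refine ⟨Φ, ⟨h0, funext fun i => ?_⟩, ?_⟩
  · have h1 := hM Φ i
    rw [hΦ', h0] at h1
    simp only [Pi.add_apply]
    linarith
  · rintro Ψ ⟨g0, g1⟩
    apply hinj
    rw [hΦ]
    funext i
    have h1 := hM Ψ i
    have h2 := congrFun g1 i
    simp only [Pi.add_apply] at h2
    rw [g0] at h1
    change (M.mulVec Ψ) i = b i
    linarith

/-- **The diffusion-map Markov matrix: stationarity and fixed-point well-posedness.**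
Let `k` be a symmetric `N×N` matrix with strictly positive entries, `dᵢ = Σⱼ kᵢⱼ`,
`Tᵢⱼ = kᵢⱼ/dᵢ` (row-stochastic) and `πᵢ = dᵢ/Σⱼdⱼ`. Then (a) `πᵀT = πᵀ`, and
(b) for every `b` with `Σᵢ πᵢbᵢ = 0` there is a unique `Φ` with `Σᵢ πᵢΦᵢ = 0`
satisfying the fixed-point equation `Φ = TΦ + b`. -/
theorem diffusion_map_markov_matrix
    (N : ℕ) (hN : 1 ≤ N) (k : Matrix (Fin N) (Fin N) ℝ)
    (hsym : k.IsSymm) (hpos : ∀ i j, 0 < k i j) :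
    let dvec : Fin N → ℝ := fun i => ∑ j, k i j
    let T : Matrix (Fin N) (Fin N) ℝ := Matrix.of fun i j => k i j / dvec i
    let π : Fin N → ℝ := fun i => dvec i / ∑ j, dvec j
    (∀ j, ∑ i, π i * T i j = π j) ∧
    (∀ b : Fin N → ℝ, (∑ i, π i * b i = 0) →
      ∃! Φ : Fin N → ℝ, (∑ i, π i * Φ i = 0) ∧ Φ = T.mulVec Φ + b) := by
  intro dvec T π
  haveI : Nonempty (Fin N) := ⟨⟨0, hN⟩⟩
  have hd : ∀ i, 0 < dvec i := fun i =>
    Finset.sum_pos (fun j _ => hpos i j) Finset.univ_nonempty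
  have hD : 0 < ∑ j, dvec j := Finset.sum_pos (fun j _ => hd j) Finset.univ_nonempty
  have hst : ∀ j, ∑ i, π i * T i j = π j := by
    intro j
    have h1 : ∀ i, π i * T i j = k j i / ∑ j, dvec j := by
      intro i
      have h2 := (hd i).ne'
      have h3 := hD.ne'
      change dvec i / (∑ j, dvec j) * (k i j / dvec i) = _
      rw [← hsym.apply i j]
      field_simp
    simp only [h1]
    rw [← Finset.sum_div]
  refine ⟨hst, fun b hb => markov_poisson N hN T π ?_ ?_ ?_ hst b hb⟩
  · exact fun i j => div_pos (hpos i j) (hd i)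
  · intro i
    change ∑ j, k i j / dvec i = 1
    rw [← Finset.sum_div]
    exact div_self (hd i).ne'
  · change ∑ i, dvec i / (∑ j, dvec j) = 1
    rw [← Finset.sum_div]
    exact div_self hD.ne'
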